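/- Every order-based semantics is +-decomposable but not +-composable: if ⪯ is a suitable order, then S_⪯(D,R+R′) ⊆ S_⪯(D,R) ∪ S_⪯(D,R′) for all databases D and regular expressions R,R′, and there exist a database D and regular expressions R,R′ such that S_⪯(D,R) ∪ S_⪯(D,R′) is not a subset of S_⪯(D,R+R′). -/

import Mathlib

namespace RPQ

/-- Vertex identifiers. -/
abbrev V : Type := ℕ
/-- Edge identifiers. -/
abbrev Edg : Type := ℕ
/-- Labels. -/
abbrev Lab : Type := ℕ

/-- A walk: a nonempty alternating sequence `v₀,e₁,v₁,…,e_k,v_k`, encoded as the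
initial vertex together with the list of (edge, next-vertex) pairs. -/
structure Walk where
  head : V
  steps : List (Edg × V)
deriving DecidableEq

namespace Walk

def length (w : Walk) : ℕ := w.steps.length
def src (w : Walk) : V := w.head
def tgt (w : Walk) : V := (w.steps.map Prod.snd).getLastD w.head
/-- The pair of endpoints of a walk. -/
def ep (w : Walk) : V × V := (w.src, w.tgt)
def vertexList (w : Walk) : List V := w.head :: w.steps.map Prod.snd
def edgeList (w : Walk) : List Edg := w.steps.map Prod.fst
/-- Concatenation of walks (meaningful when `w.tgt = w'.src`). -/
def concat (w w' : Walk) : Walk := ⟨w.head, w.steps ++ w'.steps⟩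

end Walk

/-- A graph database. -/
structure Database where
  labels : Finset Lab
  verts : Finset V
  edges : Finset Edg
  src : Edg → V
  tgt : Edg → V
  lbl : Edg → Lab
  src_mem : ∀ e ∈ edges, src e ∈ verts
  tgt_mem : ∀ e ∈ edges, tgt e ∈ verts
  lbl_mem : ∀ e ∈ edges, lbl e ∈ labels

def chainFrom (D : Database) : V → List (Edg × V) → Prop
  | _, [] => True
  | v, (e, v') :: rest =>
      e ∈ D.edges ∧ D.src e = v ∧ D.tgt e = v' ∧ chainFrom D v' rest

/-- `w` is consistent with `D`, i.e. `w` is a walk in `D`. -/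
def Walk.Consistent (D : Database) (w : Walk) : Prop :=
  w.head ∈ D.verts ∧ chainFrom D w.head w.steps

/-- The set of walks in `D`. -/
def Walks (D : Database) : Set Walk := {w | w.Consistent D}

/-- The label of a walk in `D`: the word of its successive edge labels. -/
def Walk.label (D : Database) (w : Walk) : List Lab :=
  w.steps.map fun p => D.lbl p.1

abbrev RE := RegularExpression Lab

/-- Matches of `R` in `D`: walks in `D` whose label conforms to `R`. -/
def Matches (D : Database) (R : RE) : Set Walk :=
  {w | w.Consistent D ∧ w.label D ∈ R.matches'}

/-- A semantics maps a database and a query to a finite subset of its matches. -/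
def IsSemantics (S : Database → RE → Set Walk) : Prop :=
  ∀ D R, S D R ⊆ Matches D R ∧ (S D R).Finite

/-- `S` is walk-based. -/
def WalkBased (S : Database → RE → Set Walk) : Prop :=
  ∃ r : Set Walk → Set Walk, ∀ D R, S D R = r (Matches D R)

/-- The semantics defined by a filter `f`. -/
def FilterSem (f : Walk → Bool) (D : Database) (R : RE) : Set Walk :=
  {w ∈ Matches D R | f w = true}

/-- Componentwise inclusion of databases. -/
def Database.Sub (D D' : Database) : Prop :=
  D.labels ⊆ D'.labels ∧ D.verts ⊆ D'.verts ∧ D.edges ⊆ D'.edges ∧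
    ∀ e ∈ D.edges, D'.src e = D.src e ∧ D'.tgt e = D.tgt e ∧ D'.lbl e = D.lbl e

def IsPartialOrderRel (le : Walk → Walk → Prop) : Prop :=
  (∀ w, le w w) ∧ (∀ a b c, le a b → le b c → le a c) ∧ ∀ a b, le a b → le b a → a = b

/-- `le` is a well-partial-order on the walks of `D`. -/
def IsWpoOn (le : Walk → Walk → Prop) (D : Database) : Prop :=
  ∀ f : ℕ → Walk, (∀ n, (f n).Consistent D) → ∃ i j, i < j ∧ le (f i) (f j)

/-- Suitable order: a partial order on walks that is a wpo on `Walks D` for each `D`. -/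
def Suitable (le : Walk → Walk → Prop) : Prop :=
  IsPartialOrderRel le ∧ ∀ D, IsWpoOn le D

/-- The semantics based on the order `le`: the `le`-minimal matches among those
with the same endpoints. -/
def OrderSem (le : Walk → Walk → Prop) (D : Database) (R : RE) : Set Walk :=
  {w ∈ Matches D R | ∀ w' ∈ Matches D R, w'.ep = w.ep → le w' w → w' = w}

def Monotonous (S : Database → RE → Set Walk) : Prop :=
  ∀ D D' R, D.Sub D' → S D R ⊆ S D' R

def CoMonotonous (S : Database → RE → Set Walk) : Prop :=
  ∀ D D' R, D.Sub D' → S D' R ∩ Walks D ⊆ S D R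

def Stabilizing (S : Database → RE → Set Walk) : Prop :=
  ∀ (D : Database) (Rs : ℕ → RE),
    (∀ i j, i ≤ j → ∀ u, u ∈ (Rs i).matches' → u ∈ (Rs j).matches') →
    ∃ N, ∀ n, N ≤ n → S D (Rs n) = S D (Rs N)

/-- Concatenation lifted to sets of walks. -/
def setConcat (W W' : Set Walk) : Set Walk :=
  {u | ∃ w ∈ W, ∃ w' ∈ W', w.tgt = w'.src ∧ u = w.concat w'}

/-- `setStar W` : all concatenations `w₁·…·w_k` (k ≥ 1) of walks of `W`. -/
inductive setStar (W : Set Walk) : Walk → Prop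
  | base : ∀ w ∈ W, setStar W w
  | step : ∀ u w, setStar W u → w ∈ W → u.tgt = w.src → setStar W (u.concat w)

/-- Walks jointly consistent with some database. -/
def ConsistentPair (w w' : Walk) : Prop :=
  ∃ D : Database, w.Consistent D ∧ w'.Consistent D

/-- The trimming of an order. -/
def trimRel (le : Walk → Walk → Prop) (w w' : Walk) : Prop :=
  ConsistentPair w w' ∧ w.ep = w'.ep ∧ le w w'

def Trimmed (le : Walk → Walk → Prop) : Prop := trimRel le = le

/-- `le` respects element inclusion. -/
def RespectsElemIncl (le : Walk → Walk → Prop) : Prop :=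
  ∀ w w', le w w' →
    (∀ v ∈ w.vertexList, v ∈ w'.vertexList) ∧ ∀ e ∈ w.edgeList, e ∈ w'.edgeList

/-- Action of a relabeling on a database. -/
def Database.relabel (π : Equiv.Perm Lab) (D : Database) : Database where
  labels := D.labels.image (⇑π)
  verts := D.verts
  edges := D.edges
  src := D.src
  tgt := D.tgt
  lbl := fun e => π (D.lbl e)
  src_mem := D.src_mem
  tgt_mem := D.tgt_mem
  lbl_mem := fun e he => Finset.mem_image_of_mem (⇑π) (D.lbl_mem e he)

/-- Action of a renaming on a walk. -/
def Walk.rename (νv : Equiv.Perm V) (νe : Equiv.Perm Edg) (w : Walk) : Walk :=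
  ⟨νv w.head, w.steps.map fun p => (νe p.1, νv p.2)⟩

/-- Action of a renaming on a database. -/
def Database.rename (νv : Equiv.Perm V) (νe : Equiv.Perm Edg) (D : Database) :
    Database where
  labels := D.labels
  verts := D.verts.image (⇑νv)
  edges := D.edges.image (⇑νe)
  src := fun e => νv (D.src (νe.symm e))
  tgt := fun e => νv (D.tgt (νe.symm e))
  lbl := fun e => D.lbl (νe.symm e)
  src_mem := by
    intro e he
    obtain ⟨e', he', rfl⟩ := Finset.mem_image.mp he
    simpa using Finset.mem_image_of_mem (⇑νv) (D.src_mem e' he')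
  tgt_mem := by
    intro e he
    obtain ⟨e', he', rfl⟩ := Finset.mem_image.mp he
    simpa using Finset.mem_image_of_mem (⇑νv) (D.tgt_mem e' he')
  lbl_mem := by
    intro e he
    obtain ⟨e', he', rfl⟩ := Finset.mem_image.mp he
    simpa using D.lbl_mem e' he'

/-- Identifier independence. -/
def IdIndependent (S : Database → RE → Set Walk) : Prop :=
  ∀ (νv : Equiv.Perm V) (νe : Equiv.Perm Edg) (D : Database) (R : RE),
    Walk.rename νv νe '' S D R = S (Database.rename νv νe D) R

/-- Unbounded semantics. -/
def Unbounded (S : Database → RE → Set Walk) : Prop :=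
  ∀ n : ℕ, ∃ (D : Database) (R : RE) (w : Walk), w ∈ S D R ∧ n ≤ w.length

/-- Shortest-walk semantics. -/
def Sh (D : Database) (R : RE) : Set Walk :=
  {w ∈ Matches D R | ∀ w' ∈ Matches D R, w'.ep = w.ep → w.length ≤ w'.length}

/-- The factor-inserting relation `F`. -/
def FactorIns (w w' : Walk) : Prop :=
  ∃ w₁ w₂ w₃ : Walk, w₁.tgt = w₂.src ∧ w₂.tgt = w₃.src ∧ w₁.tgt = w₃.src ∧
    w = w₁.concat w₃ ∧ w' = (w₁.concat w₂).concat w₃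

/-- The subwalk order: reflexive–transitive closure of `FactorIns`. -/
def SubwalkOrd : Walk → Walk → Prop := Relation.ReflTransGen FactorIns

/-- The database with one vertex and one loop edge. -/
def loopDatabase : Database where
  labels := {0}
  verts := {0}
  edges := {0}
  src := fun _ => 0
  tgt := fun _ => 0
  lbl := fun _ => 0
  src_mem := by simp
  tgt_mem := by simp
  lbl_mem := by simp

/-- The walk that follows the loop of `loopDatabase` `n` times. -/
def loopWalk (n : ℕ) : Walk := ⟨0, List.replicate n (0, 0)⟩

theorem chainFrom_loopDatabase_iff (l : List (Edg × V)) :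
    chainFrom loopDatabase 0 l ↔ l = List.replicate l.length (0, 0) := by
  induction l with
  | nil => simp [chainFrom]
  | cons p l ih =>
    obtain ⟨e, v⟩ := p
    constructor
    · rintro ⟨he, -, rfl, hl⟩
      have he0 : e = 0 := by simpa [loopDatabase] using he
      have hl' := ih.mp hl
      rw [List.length_cons, List.replicate_succ, ← hl', he0]
      rfl
    · intro h
      rw [List.length_cons, List.replicate_succ, List.cons.injEq, Prod.mk.injEq] at h
      obtain ⟨⟨rfl, rfl⟩, hl⟩ := h
      exact ⟨by simp [loopDatabase], rfl, rfl, ih.mpr hl⟩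

theorem consistent_loopDatabase_iff (w : Walk) :
    w.Consistent loopDatabase ↔ w = loopWalk w.length := by
  obtain ⟨v, l⟩ := w
  have hv : v ∈ loopDatabase.verts ↔ v = 0 := by simp [loopDatabase]
  simp only [Walk.Consistent, hv, loopWalk, Walk.length, Walk.mk.injEq]
  refine and_congr_right ?_
  rintro rfl
  exact chainFrom_loopDatabase_iff l

theorem length_loopWalk (n : ℕ) : (loopWalk n).length = n := by
  simp [loopWalk, Walk.length]

theorem loopWalk_consistent (n : ℕ) : (loopWalk n).Consistent loopDatabase := by
  rw [consistent_loopDatabase_iff, length_loopWalk]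

theorem ep_loopWalk (n : ℕ) : (loopWalk n).ep = (0, 0) := by
  cases n <;> simp [loopWalk, Walk.ep, Walk.src, Walk.tgt, List.getLast?_replicate]

theorem mem_matches'_char_pow_iff {α : Type*} (a : α) (n : ℕ) (u : List α) :
    u ∈ (RegularExpression.char a ^ n).matches' ↔ u = List.replicate n a := by
  rw [RegularExpression.matches'_pow, RegularExpression.matches'_char]
  induction n generalizing u with
  | zero => simp [Language.mem_one]
  | succ n ih =>
    rw [pow_succ', Language.mem_mul, List.replicate_succ]
    constructor
    · rintro ⟨x, hx, y, hy, rfl⟩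
      have hx' : x = [a] := hx
      rw [hx', (ih y).mp hy, List.singleton_append]
    · rintro rfl
      exact ⟨[a], rfl, _, (ih _).mpr rfl, rfl⟩

theorem mem_matches_loopDatabase_char_pow_iff (n : ℕ) (w : Walk) :
    w ∈ Matches loopDatabase (RegularExpression.char 0 ^ n) ↔ w = loopWalk n := by
  have hlabel : w.label loopDatabase = List.replicate w.length 0 := by
    simp [Walk.label, loopDatabase, Walk.length]
  change w.Consistent loopDatabase ∧
    w.label loopDatabase ∈ (RegularExpression.char 0 ^ n).matches' ↔ _
  rw [mem_matches'_char_pow_iff, hlabel, consistent_loopDatabase_iff]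
  constructor
  · rintro ⟨hw, hn⟩
    rwa [show w.length = n by simpa using congrArg List.length hn] at hw
  · rintro rfl
    simp [length_loopWalk]

theorem mem_matches_add_iff (D : Database) (R R' : RE) (w : Walk) :
    w ∈ Matches D (R + R') ↔ w ∈ Matches D R ∨ w ∈ Matches D R' :=
  and_or_left

/-- Every order-based semantics is +-decomposable but not +-composable. -/
theorem orderBased_plusDecomposable_not_plusComposable
    (le : Walk → Walk → Prop) (hle : Suitable le) :
    (∀ (D : Database) (R R' : RE),
        OrderSem le D (R + R') ⊆ OrderSem le D R ∪ OrderSem le D R') ∧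
      ∃ (D : Database) (R R' : RE),
        ¬ (OrderSem le D R ∪ OrderSem le D R' ⊆ OrderSem le D (R + R')) := by
  refine ⟨?_, ?_⟩
  · rintro D R R' w ⟨hw, hmin⟩
    have hmin' := fun w' h => hmin w' ((mem_matches_add_iff D R R' w').mpr h)
    exact ((mem_matches_add_iff D R R' w).mp hw).imp
      (fun h => ⟨h, fun w' hw' => hmin' w' (.inl hw')⟩)
      (fun h => ⟨h, fun w' hw' => hmin' w' (.inr hw')⟩)
  · obtain ⟨i, j, hij, hle_ij⟩ := hle.2 loopDatabase loopWalk loopWalk_consistent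
    refine ⟨loopDatabase, .char 0 ^ i, .char 0 ^ j, fun hsub => ?_⟩
    have hj : loopWalk j ∈ OrderSem le loopDatabase (.char 0 ^ j) :=
      ⟨(mem_matches_loopDatabase_char_pow_iff j _).mpr rfl,
        fun w hw _ _ => (mem_matches_loopDatabase_char_pow_iff j w).mp hw⟩
    have hi := (mem_matches_loopDatabase_char_pow_iff i (loopWalk i)).mpr rfl
    have heq := (hsub (.inr hj)).2 (loopWalk i) ((mem_matches_add_iff _ _ _ _).mpr (.inl hi))
      (by rw [ep_loopWalk, ep_loopWalk]) hle_ij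
    have := congrArg Walk.length heq
    rw [length_loopWalk, length_loopWalk] at this
    exact hij.ne this

end RPQ
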